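/- Let (X,ρ,μ) be a quasi-metric measure space with μ doubling, and let Ω ⊂ X be a nonempty μ-measurable set satisfying the measure density condition. Suppose u: Ω→ℝ belongs locally to Ṁ^{ε,p}(Ω,ρ,μ) for some ε,p ∈ (0,∞), in the sense that u ∈ Ṁ^{ε,p}(B∩Ω,ρ,μ) for every ρ-ball B ⊂ X centered in Ω. Then lim_{r→0⁺} m_u(B_ρ(x,r)∩Ω) = u(x) for μ-almost every x ∈ Ω. In particular, this holds whenever u ∈ Ṁ^s_{p,q}(Ω,ρ,μ) or u ∈ Ṅ^s_{p,q}(Ω,ρ,μ) for some s,p ∈ (0,∞) and q ∈ (0,∞]. -/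

import Mathlib

open MeasureTheory ENNReal Set

noncomputable section

namespace HajlaszPaper

variable {X : Type*}

/-- The `ρ`-ball centered at `x` with radius `r`. -/
def qball (ρ : X → X → ℝ) (x : X) (r : ℝ) : Set X := {y | ρ x y < r}

/-- `ρ` is a quasi-metric on `X`. -/
def IsQuasiDist (ρ : X → X → ℝ) : Prop :=
  (∀ x y, 0 ≤ ρ x y) ∧ (∀ x y, ρ x y = 0 ↔ x = y) ∧
    (∃ C₀ : ℝ, 1 ≤ C₀ ∧ ∀ x y, ρ y x ≤ C₀ * ρ x y) ∧
    (∃ C₁ : ℝ, 1 ≤ C₁ ∧ ∀ x y z, ρ x y ≤ C₁ * max (ρ x z) (ρ z y))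

/-- The least admissible quasi-triangle constant `C_ρ`. -/
def Crho (ρ : X → X → ℝ) : ℝ :=
  sInf {C : ℝ | 1 ≤ C ∧ ∀ x y z : X, ρ x y ≤ C * max (ρ x z) (ρ z y)}

/-- The least admissible quasi-symmetry constant `C̃_ρ`. -/
def CrhoTilde (ρ : X → X → ℝ) : ℝ :=
  sInf {C : ℝ | 1 ≤ C ∧ ∀ x y : X, ρ y x ≤ C * ρ x y}

/-- Two quasi-metrics are (bi-Lipschitz, i.e. pointwise) equivalent. -/
def EquivQM (ρ ϱ : X → X → ℝ) : Prop :=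
  ∃ c : ℝ, 1 ≤ c ∧ ∀ x y, c⁻¹ * ϱ x y ≤ ρ x y ∧ ρ x y ≤ c * ϱ x y

variable [MeasurableSpace X]

/-- `(X, ρ, μ)` is a quasi-metric measure space. -/
structure IsQMMS (ρ : X → X → ℝ) (μ : Measure X) : Prop where
  nontrivial : ∃ x y : X, x ≠ y
  quasi : IsQuasiDist ρ
  measurableSet_ball : ∀ (x : X) (r : ℝ), 0 < r → MeasurableSet (qball ρ x r)
  ball_pos : ∀ (x : X) (r : ℝ), 0 < r → 0 < μ (qball ρ x r)
  ball_lt_top : ∀ (x : X) (r : ℝ), 0 < r → μ (qball ρ x r) < ∞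

/-- Every `μ`-measurable set is contained in a Borel (measurable) set of equal measure. -/
def BorelRegular (μ : Measure X) : Prop :=
  ∀ A : Set X, ∃ B : Set X, A ⊆ B ∧ MeasurableSet B ∧ μ A = μ B

/-- `μ` is `Q`-doubling. -/
def QDoubling (ρ : X → X → ℝ) (μ : Measure X) (Q : ℝ) : Prop :=
  ∃ κ : ℝ, 0 < κ ∧ ∀ (x y : X) (r R : ℝ), 0 < r → r ≤ R →
    qball ρ x r ⊆ qball ρ y R →
    ENNReal.ofReal (κ * (r / R) ^ Q) * μ (qball ρ y R) ≤ μ (qball ρ x r)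

/-- `μ` is doubling. -/
def DoublingMeas (ρ : X → X → ℝ) (μ : Measure X) : Prop :=
  ∃ Cd : ℝ, 0 < Cd ∧ ∀ (x : X) (r : ℝ), 0 < r →
    μ (qball ρ x (2 * r)) ≤ ENNReal.ofReal Cd * μ (qball ρ x r)

/-- The measure density condition for `Ω`. -/
def MeasDensity (ρ : X → X → ℝ) (μ : Measure X) (Ω : Set X) : Prop :=
  ∃ c : ℝ, 0 < c ∧ ∀ x ∈ Ω, ∀ r : ℝ, 0 < r → r ≤ 1 →
    μ (qball ρ x r) ≤ ENNReal.ofReal c * μ (qball ρ x r ∩ Ω)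

/-- `Ω` is locally uniformly perfect with constant `lam ∈ (0,1)`. -/
def LocUnifPerfect (ρ : X → X → ℝ) (Ω : Set X) (lam : ℝ) : Prop :=
  ∀ x ∈ Ω, ∀ r : ℝ, 0 < r → r ≤ 1 → (Ω \ qball ρ x r).Nonempty →
    ((qball ρ x r ∩ Ω) \ qball ρ x (lam * r)).Nonempty

/-- The critical radius `φ^x_{Ω,ρ}(r)`. -/
def phiRad (ρ : X → X → ℝ) (μ : Measure X) (Ω : Set X) (x : X) (r : ℝ) : ℝ :=
  sSup {t : ℝ | 0 ≤ t ∧ t ≤ r ∧ μ (qball ρ x t ∩ Ω) ≤ μ (qball ρ x r ∩ Ω) / 2}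

/-- The collection `𝔻^s_ρ(u)` of fractional `s`-gradients of `u` on `Ω`. -/
def fracGrad (ρ : X → X → ℝ) (μ : Measure X) (Ω : Set X) (s : ℝ) (u : X → ℝ) :
    Set (ℤ → X → ℝ) :=
  {g | (∀ k x, 0 ≤ g k x) ∧ (∀ k, AEMeasurable (g k) (μ.restrict Ω)) ∧
    ∃ E : Set X, μ E = 0 ∧ ∀ k : ℤ, ∀ x ∈ Ω \ E, ∀ y ∈ Ω \ E,
      (2 : ℝ) ^ (-k - 1) ≤ ρ x y → ρ x y < (2 : ℝ) ^ (-k) →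
      |u x - u y| ≤ ρ x y ^ s * (g k x + g k y)}

/-- `g` is an `s`-gradient of `u` on `S`. -/
def IsSGradOn (ρ : X → X → ℝ) (μ : Measure X) (S : Set X) (s : ℝ) (u g : X → ℝ) : Prop :=
  (∀ x, 0 ≤ g x) ∧ AEMeasurable g (μ.restrict S) ∧
    ∃ E : Set X, μ E = 0 ∧ ∀ x ∈ S \ E, ∀ y ∈ S \ E,
      |u x - u y| ≤ ρ x y ^ s * (g x + g y)

/-- The `ℓ^q` norm (`0 < q ≤ ∞`) of a `ℤ`-indexed sequence in `[0,∞]`. -/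
def lqN (q : ℝ≥0∞) (a : ℤ → ℝ≥0∞) : ℝ≥0∞ :=
  if q = ∞ then ⨆ k, a k else (∑' k, a k ^ q.toReal) ^ (1 / q.toReal)

/-- The `L^p` "norm" (`0 < p < ∞`) of a `[0,∞]`-valued function. -/
def lpN (μ : Measure X) (p : ℝ) (f : X → ℝ≥0∞) : ℝ≥0∞ :=
  (∫⁻ x, f x ^ p ∂μ) ^ (1 / p)

/-- The `L^p` norm of `u : X → ℝ` over the set `Ω`. -/
def lpOn (μ : Measure X) (Ω : Set X) (p : ℝ) (u : X → ℝ) : ℝ≥0∞ :=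
  lpN (μ.restrict Ω) p fun x => ENNReal.ofReal |u x|

/-- The homogeneous Hajłasz–Triebel–Lizorkin quasi-norm `‖u‖_{Ṁ^s_{p,q}(Ω,ρ,μ)}`. -/
def MdotNorm (ρ : X → X → ℝ) (μ : Measure X) (Ω : Set X) (s p : ℝ) (q : ℝ≥0∞)
    (u : X → ℝ) : ℝ≥0∞ :=
  ⨅ g ∈ fracGrad ρ μ Ω s u,
    lpN (μ.restrict Ω) p fun x => lqN q fun k => ENNReal.ofReal (g k x)

/-- The homogeneous Hajłasz–Besov quasi-norm `‖u‖_{Ṅ^s_{p,q}(Ω,ρ,μ)}`. -/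
def NdotNorm (ρ : X → X → ℝ) (μ : Measure X) (Ω : Set X) (s p : ℝ) (q : ℝ≥0∞)
    (u : X → ℝ) : ℝ≥0∞ :=
  ⨅ g ∈ fracGrad ρ μ Ω s u,
    lqN q fun k => lpN (μ.restrict Ω) p fun x => ENNReal.ofReal (g k x)

/-- Membership in `M^s_{p,q}(Ω,ρ,μ)`. -/
def MemMspq (ρ : X → X → ℝ) (μ : Measure X) (Ω : Set X) (s p : ℝ) (q : ℝ≥0∞)
    (u : X → ℝ) : Prop :=
  AEMeasurable u (μ.restrict Ω) ∧ lpOn μ Ω p u ≠ ∞ ∧ MdotNorm ρ μ Ω s p q u ≠ ∞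

/-- Membership in `N^s_{p,q}(Ω,ρ,μ)`. -/
def MemNspq (ρ : X → X → ℝ) (μ : Measure X) (Ω : Set X) (s p : ℝ) (q : ℝ≥0∞)
    (u : X → ℝ) : Prop :=
  AEMeasurable u (μ.restrict Ω) ∧ lpOn μ Ω p u ≠ ∞ ∧ NdotNorm ρ μ Ω s p q u ≠ ∞

/-- The quasi-norm of `M^s_{p,q}(Ω,ρ,μ)`. -/
def MNorm (ρ : X → X → ℝ) (μ : Measure X) (Ω : Set X) (s p : ℝ) (q : ℝ≥0∞)
    (u : X → ℝ) : ℝ≥0∞ :=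
  MdotNorm ρ μ Ω s p q u + lpOn μ Ω p u

/-- The quasi-norm of `N^s_{p,q}(Ω,ρ,μ)`. -/
def NNorm (ρ : X → X → ℝ) (μ : Measure X) (Ω : Set X) (s p : ℝ) (q : ℝ≥0∞)
    (u : X → ℝ) : ℝ≥0∞ :=
  NdotNorm ρ μ Ω s p q u + lpOn μ Ω p u

/-- `s ⪯_q ind(X,ρ)` : there is a quasi-metric `ϱ ≈ ρ` with `s ≤ (log₂ C_ϱ)⁻¹`
(equivalently `C_ϱ ^ s ≤ 2`), where equality is permitted only when `q = ∞`. -/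
def SPrecIndex (ρ : X → X → ℝ) (s : ℝ) (q : ℝ≥0∞) : Prop :=
  ∃ ϱ : X → X → ℝ, IsQuasiDist ϱ ∧ EquivQM ρ ϱ ∧
    (Crho ϱ ^ s < 2 ∨ (q = ∞ ∧ Crho ϱ ^ s ≤ 2))

/-- `s < ind(X,ρ)` : there is a quasi-metric `ϱ ≈ ρ` with `s < (log₂ C_ϱ)⁻¹`
(equivalently `C_ϱ ^ s < 2`). -/
def SLtIndex (ρ : X → X → ℝ) (s : ℝ) : Prop :=
  ∃ ϱ : X → X → ℝ, IsQuasiDist ϱ ∧ EquivQM ρ ϱ ∧ Crho ϱ ^ s < 2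

/-- The median value `m_u(E)`. -/
def medianVal (μ : Measure X) (E : Set X) (u : X → ℝ) : ℝ :=
  sSup {θ : ℝ | μ {x ∈ E | u x < θ} ≤ μ E / 2}

/-- `f` belongs to the homogeneous Hölder space `Ċ^α(X,ρ)`. -/
def MemHolder (ρ : X → X → ℝ) (α : ℝ) (f : X → ℝ) : Prop :=
  ∃ H : ℝ, 0 ≤ H ∧ ∀ x y : X, |f x - f y| ≤ H * ρ x y ^ α

/-- The Hölder seminorm `‖f‖_{Ċ^α(X,ρ)}`. -/
def holderNorm (ρ : X → X → ℝ) (α : ℝ) (f : X → ℝ) : ℝ :=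
  sInf {H : ℝ | 0 ≤ H ∧ ∀ x y : X, |f x - f y| ≤ H * ρ x y ^ α}

/-- The sup norm of `f`. -/
def supNorm (f : X → ℝ) : ℝ := sSup (Set.range fun x => |f x|)

/-- `ρ` is a genuine metric. -/
def IsMetricDist (ρ : X → X → ℝ) : Prop :=
  (∀ x y, 0 ≤ ρ x y) ∧ (∀ x y, ρ x y = 0 ↔ x = y) ∧ (∀ x y, ρ x y = ρ y x) ∧
    (∀ x y z, ρ x y ≤ ρ x z + ρ z y)

/-- The homogeneous Hajłasz–Sobolev quasi-norm `‖u‖_{Ṁ^{1,p}(Ω,ρ,μ)}`. -/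
def M1pDotNorm (ρ : X → X → ℝ) (μ : Measure X) (Ω : Set X) (p : ℝ) (u : X → ℝ) : ℝ≥0∞ :=
  ⨅ g ∈ {g : X → ℝ | IsSGradOn ρ μ Ω 1 u g},
    lpN (μ.restrict Ω) p fun x => ENNReal.ofReal (g x)

/-- Membership in the Hajłasz–Sobolev space `M^{1,p}(Ω,ρ,μ)`. -/
def MemM1p (ρ : X → X → ℝ) (μ : Measure X) (Ω : Set X) (p : ℝ) (u : X → ℝ) : Prop :=
  AEMeasurable u (μ.restrict Ω) ∧ lpOn μ Ω p u ≠ ∞ ∧ M1pDotNorm ρ μ Ω p u ≠ ∞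

/-- The quasi-norm of `M^{1,p}(Ω,ρ,μ)`. -/
def M1pNorm (ρ : X → X → ℝ) (μ : Measure X) (Ω : Set X) (p : ℝ) (u : X → ℝ) : ℝ≥0∞ :=
  lpOn μ Ω p u + M1pDotNorm ρ μ Ω p u
section Metrization

open Filter Topology

/-- The distance of `X` is comparable to the power `ρ ^ α` of the quasi-metric `ρ`. -/
structure DistComparable {X : Type*} [PseudoMetricSpace X] (ρ : X → X → ℝ) (A α : ℝ) : Prop where
  nonneg : ∀ x y, 0 ≤ ρ x y
  one_le : 1 ≤ A
  pos : 0 < α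
  dist_le : ∀ x y, dist x y ≤ A * ρ x y ^ α
  le_dist : ∀ x y, ρ x y ^ α ≤ 2 * dist x y

theorem exists_rpow_two_mul_le {C : ℝ} (hC : 1 ≤ C) : ∃ α : ℝ, 0 < α ∧ C ^ (2 * α) ≤ 2 := by
  have hl : 0 ≤ Real.log C := Real.log_nonneg hC
  have h2 : 0 < Real.log 2 := Real.log_pos (by norm_num)
  refine ⟨Real.log 2 / (2 * Real.log C + 1), by positivity, ?_⟩
  rw [← Real.log_le_log_iff (by positivity) (by norm_num), Real.log_rpow (by positivity)]
  have : 2 * (Real.log 2 / (2 * Real.log C + 1)) * Real.log C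
      = Real.log 2 * ((2 * Real.log C) / (2 * Real.log C + 1)) := by ring
  rw [this]
  exact mul_le_of_le_one_right h2.le ((div_le_one (by positivity)).2 (by linarith))

/-- Metrization of a quasi-metric, up to taking a power. -/
theorem exists_distComparable {X : Type*} {ρ : X → X → ℝ} (h : IsQuasiDist ρ) :
    ∃ (_ : PseudoMetricSpace X) (A α : ℝ), DistComparable ρ A α := by
  obtain ⟨h0, hid, ⟨C₀, hC₀, hsymm⟩, C₁, hC₁, htri⟩ := h
  obtain ⟨α, hα, hCα⟩ := exists_rpow_two_mul_le hC₁
  have hs0 : ∀ x y, 0 ≤ max (ρ x y) (ρ y x) := fun x y => le_max_of_le_left (h0 x y)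
  let d : X → X → NNReal := fun x y =>
    ⟨max (ρ x y) (ρ y x) ^ α, Real.rpow_nonneg (hs0 x y) α⟩
  have hself : ∀ x, d x x = 0 := fun x => by
    apply NNReal.eq
    change max (ρ x x) (ρ x x) ^ α = 0
    rw [max_self, (hid x x).2 rfl, Real.zero_rpow hα.ne']
  have hcomm : ∀ x y, d x y = d y x := fun x y => by ext; simp [d, max_comm]
  have htri' : ∀ x y z, max (ρ x y) (ρ y x)
      ≤ C₁ * max (max (ρ x z) (ρ z x)) (max (ρ z y) (ρ y z)) := by
    intro x y z
    refine max_le ((htri x y z).trans ?_) ((htri y x z).trans ?_)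
    · gcongr
      exacts [le_max_left _ _, le_max_left _ _]
    · refine mul_le_mul_of_nonneg_left ?_ (by positivity)
      exact max_le ((le_max_right _ _).trans (le_max_right _ _))
        ((le_max_right _ _).trans (le_max_left _ _))
  have hquad : ∀ x₁ x₂ x₃ x₄, d x₁ x₄ ≤ 2 * max (d x₁ x₂) (max (d x₂ x₃) (d x₃ x₄)) := by
    intro x₁ x₂ x₃ x₄
    obtain ⟨m, hm⟩ : ∃ m, m = max (max (ρ x₁ x₂) (ρ x₂ x₁))
      (max (max (ρ x₂ x₃) (ρ x₃ x₂)) (max (ρ x₃ x₄) (ρ x₄ x₃))) := ⟨_, rfl⟩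
    have hm0 : 0 ≤ m := hm ▸ le_max_of_le_left (hs0 _ _)
    have hle : max (ρ x₁ x₄) (ρ x₄ x₁) ≤ C₁ ^ 2 * m := by
      refine (htri' x₁ x₄ x₂).trans ?_
      have h12 : max (ρ x₁ x₂) (ρ x₂ x₁) ≤ C₁ * m := by
        refine le_trans ?_ (le_mul_of_one_le_left hm0 hC₁)
        rw [hm]; exact le_max_left _ _
      have h24 : max (ρ x₂ x₄) (ρ x₄ x₂) ≤ C₁ * m := by
        refine (htri' x₂ x₄ x₃).trans ?_
        gcongr
        rw [hm]; exact le_max_right _ _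
      calc _ ≤ C₁ * (C₁ * m) := by gcongr; exact max_le h12 h24
        _ = _ := by ring
    have hmα : m ^ α = max (max (ρ x₁ x₂) (ρ x₂ x₁) ^ α)
        (max (max (ρ x₂ x₃) (ρ x₃ x₂) ^ α) (max (ρ x₃ x₄) (ρ x₄ x₃) ^ α)) := by
      rw [hm, (Real.monotoneOn_rpow_Ici_of_exponent_nonneg hα.le).map_max (hs0 _ _)
          (le_max_of_le_left (hs0 _ _) : (0 : ℝ) ≤ _),
        (Real.monotoneOn_rpow_Ici_of_exponent_nonneg hα.le).map_max (hs0 _ _) (hs0 _ _)]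
    rw [← NNReal.coe_le_coe]
    push_cast
    change max (ρ x₁ x₄) (ρ x₄ x₁) ^ α ≤ 2 * max (max (ρ x₁ x₂) (ρ x₂ x₁) ^ α)
        (max (max (ρ x₂ x₃) (ρ x₃ x₂) ^ α) (max (ρ x₃ x₄) (ρ x₄ x₃) ^ α))
    rw [← hmα]
    calc _ ≤ (C₁ ^ 2 * m) ^ α := Real.rpow_le_rpow (hs0 _ _) hle hα.le
      _ = C₁ ^ (2 * α) * m ^ α := by
        rw [Real.mul_rpow (by positivity) hm0, Real.rpow_mul (by positivity)]; norm_num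
      _ ≤ 2 * m ^ α := by gcongr
  refine ⟨PseudoMetricSpace.ofPreNNDist d hself hcomm, C₀ ^ α, α, ?_⟩
  let _ := PseudoMetricSpace.ofPreNNDist d hself hcomm
  refine ⟨h0, Real.one_le_rpow hC₀ hα.le, hα, fun x y => ?_, fun x y => ?_⟩
  · refine (PseudoMetricSpace.dist_ofPreNNDist_le d hself hcomm x y).trans ?_
    change max (ρ x y) (ρ y x) ^ α ≤ _
    rw [← Real.mul_rpow (by positivity) (h0 x y)]
    exact Real.rpow_le_rpow (hs0 _ _)
      (max_le (le_mul_of_one_le_left (h0 _ _) hC₀) (hsymm x y)) hα.le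
  · refine le_trans ?_ (PseudoMetricSpace.le_two_mul_dist_ofPreNNDist d hself hcomm hquad x y)
    exact Real.rpow_le_rpow (h0 _ _) (le_max_left _ _) hα.le

namespace DistComparable

variable {X : Type*} [PseudoMetricSpace X] {ρ : X → X → ℝ} {A α : ℝ}

theorem qball_subset_ball (h : DistComparable ρ A α) (x : X) {t : ℝ} (ht : 0 < t) :
    qball ρ x ((t / A) ^ α⁻¹) ⊆ Metric.ball x t := by
  have hA : 0 < A := zero_lt_one.trans_le h.one_le
  intro y hy
  rw [Metric.mem_ball']
  refine (h.dist_le x y).trans_lt ?_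
  rwa [← lt_div_iff₀' hA, ← Real.lt_rpow_inv_iff_of_pos (h.nonneg x y) (by positivity) h.pos]

theorem qball_subset_closedBall (h : DistComparable ρ A α) (x : X) (r : ℝ) :
    qball ρ x r ⊆ Metric.closedBall x (A * r ^ α) := by
  have hA : 0 < A := zero_lt_one.trans_le h.one_le
  intro y hy
  rw [Metric.mem_closedBall']
  refine (h.dist_le x y).trans ?_
  gcongr
  exacts [h.nonneg x y, h.pos.le, le_of_lt hy]

theorem closedBall_subset_qball (h : DistComparable ρ A α) (x : X) {t : ℝ} (ht : 0 < t) :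
    Metric.closedBall x t ⊆ qball ρ x ((3 * t) ^ α⁻¹) := by
  intro y hy
  rw [Metric.mem_closedBall'] at hy
  change ρ x y < _
  rw [Real.lt_rpow_inv_iff_of_pos (h.nonneg x y) (by positivity) h.pos]
  linarith [h.le_dist x y]

end DistComparable

end Metrization

section Density

open Filter Topology Metric

theorem qball_mono {X : Type*} (ρ : X → X → ℝ) (x : X) {r R : ℝ} (h : r ≤ R) :
    qball ρ x r ⊆ qball ρ x R := fun _ hy => lt_of_lt_of_le hy h

theorem DoublingMeas.exists_measure_qball_mul_le {X : Type*} [MeasurableSpace X]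
    {ρ : X → X → ℝ} {μ : Measure X} (h : DoublingMeas ρ μ) (L : ℝ) :
    ∃ C : NNReal, ∀ (x : X) (r : ℝ), 0 < r → μ (qball ρ x (L * r)) ≤ C * μ (qball ρ x r) := by
  obtain ⟨Cd, -, hd⟩ := h
  obtain ⟨n, hn⟩ := pow_unbounded_of_one_lt L (one_lt_two (α := ℝ))
  refine ⟨Cd.toNNReal ^ n, fun x r hr => ?_⟩
  have key : ∀ k : ℕ, μ (qball ρ x (2 ^ k * r)) ≤ (Cd.toNNReal ^ k : NNReal) * μ (qball ρ x r) := by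
    intro k
    induction k with
    | zero => simp
    | succ k ih =>
      calc μ (qball ρ x (2 ^ (k + 1) * r)) = μ (qball ρ x (2 * (2 ^ k * r))) := by
            rw [pow_succ', mul_assoc]
        _ ≤ ENNReal.ofReal Cd * μ (qball ρ x (2 ^ k * r)) := hd x _ (by positivity)
        _ ≤ ENNReal.ofReal Cd * ((Cd.toNNReal ^ k : NNReal) * μ (qball ρ x r)) := by gcongr
        _ = _ := by rw [← mul_assoc, ENNReal.ofReal, ← ENNReal.coe_mul, ← pow_succ']
  exact (measure_mono (qball_mono ρ x (by gcongr))).trans (key n)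

theorem iUnion_qball_natCast_add_one {X : Type*} (ρ : X → X → ℝ) (x : X) :
    ⋃ n : ℕ, qball ρ x (n + 1) = univ := by
  refine eq_univ_of_forall fun y => ?_
  obtain ⟨n, hn⟩ := exists_nat_gt (ρ x y)
  exact mem_iUnion.2 ⟨n, hn.trans (lt_add_one _)⟩

theorem IsQMMS.sigmaFinite {X : Type*} [MeasurableSpace X] {ρ : X → X → ℝ} {μ : Measure X}
    (h : IsQMMS ρ μ) : SigmaFinite μ := by
  obtain ⟨x, -⟩ := h.nontrivial
  exact ⟨⟨⟨fun n => qball ρ x (n + 1), fun _ => trivial,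
    fun n => h.ball_lt_top x _ (by positivity), iUnion_qball_natCast_add_one ρ x⟩⟩⟩

theorem _root_.IsClosed.measurableSet_borel {X : Type*} [TopologicalSpace X] {K : Set X}
    (hK : IsClosed K) : MeasurableSet[borel X] K :=
  @MeasurableSet.of_compl X K (borel X) (MeasurableSpace.measurableSet_generateFrom hK.isOpen_compl)

namespace DistComparable

variable {X : Type*} [PseudoMetricSpace X] [MeasurableSpace X] {ρ : X → X → ℝ} {μ : Measure X}
  {A α : ℝ}

theorem secondCountableTopology (h : DistComparable ρ A α) (hX : IsQMMS ρ μ) :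
    SecondCountableTopology X := by
  have := hX.sigmaFinite
  have hA : 0 < A := zero_lt_one.trans_le h.one_le
  refine Metric.secondCountable_of_almost_dense_set fun ε hε => ?_
  obtain ⟨s, hs⟩ := zorn_subset {s : Set X | s.Pairwise fun x y => ε < dist x y}
    fun c hc hchain => ⟨⋃₀ c, (pairwise_sUnion hchain.directedOn).2 hc,
      fun _ => subset_sUnion_of_mem⟩
  refine ⟨s, ?_, fun x => ?_⟩
  · have hr : 0 < (ε / 2 / A) ^ α⁻¹ := by positivity
    have hcount := Measure.countable_meas_pos_of_disjoint_iUnion (μ := μ)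
      (As := fun i : s => qball ρ i.1 ((ε / 2 / A) ^ α⁻¹))
      (fun i => hX.measurableSet_ball _ _ hr) (fun i j hij => by
        refine Disjoint.mono (h.qball_subset_ball _ (half_pos hε))
          (h.qball_subset_ball _ (half_pos hε)) (ball_disjoint_ball ?_)
        have := hs.prop i.2 j.2 (Subtype.coe_injective.ne hij)
        linarith)
    have huniv : {i : s | 0 < μ (qball ρ i.1 ((ε / 2 / A) ^ α⁻¹))} = univ :=
      eq_univ_of_forall fun i => hX.ball_pos _ _ hr
    rw [huniv, countable_univ_iff] at hcount
    exact hcount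
  · by_contra! hx
    have hins : insert x s ∈ {s : Set X | s.Pairwise fun x y => ε < dist x y} :=
      hs.prop.insert fun y hy _ => ⟨hx y hy, by rw [dist_comm]; exact hx y hy⟩
    have := hx x (hs.le_of_ge hins (subset_insert x s) (mem_insert x s))
    rw [dist_self] at this
    exact this.not_gt hε

theorem borel_le (h : DistComparable ρ A α) (hX : IsQMMS ρ μ) :
    borel X ≤ ‹MeasurableSpace X› := by
  have := h.secondCountableTopology hX
  have hA : 0 < A := zero_lt_one.trans_le h.one_le
  refine MeasurableSpace.generateFrom_le fun O (hO : IsOpen O) => ?_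
  obtain ⟨s, hsc, hsd⟩ := TopologicalSpace.exists_countable_dense X
  have hcover : O = ⋃ d ∈ s, ⋃ q ∈ {q : ℚ | 0 < q ∧ qball ρ d q ⊆ O}, qball ρ d q := by
    refine Subset.antisymm (fun y hy => ?_)
      (iUnion₂_subset fun d _ => iUnion₂_subset fun q hq => hq.2)
    obtain ⟨δ, hδ, hδO⟩ := Metric.isOpen_iff.1 hO y hy
    obtain ⟨q, hq0, hq⟩ := exists_rat_btwn (show 0 < (δ / 2 / A) ^ α⁻¹ by positivity)
    have ht : 0 < min ((q : ℝ) ^ α / 3) (δ / 2) := by positivity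
    obtain ⟨d, hds, hd⟩ := hsd.exists_dist_lt y ht
    refine mem_iUnion₂.2 ⟨d, hds, mem_iUnion₂.2 ⟨q, ⟨by exact_mod_cast hq0, ?_⟩, ?_⟩⟩
    · refine (qball_mono ρ d hq.le).trans ((h.qball_subset_ball d (half_pos hδ)).trans ?_)
      refine (ball_subset_ball' ?_).trans hδO
      rw [dist_comm]
      linarith [hd.trans_le (min_le_right _ _)]
    · refine qball_mono ρ d (le_of_eq ?_)
        (h.closedBall_subset_qball d (t := (q : ℝ) ^ α / 3) (by positivity) ?_)
      · rw [mul_div_cancel₀ _ (by norm_num), Real.rpow_rpow_inv hq0.le h.pos.ne']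
      · exact (hd.trans_le (min_le_left _ _)).le
  rw [hcover]
  exact MeasurableSet.biUnion hsc fun d _ => MeasurableSet.biUnion (to_countable _)
    fun q hq => hX.measurableSet_ball d q (by exact_mod_cast hq.1)

theorem exists_measure_closedBall_two_mul_le (h : DistComparable ρ A α)
    (hdoub : DoublingMeas ρ μ) :
    ∃ C : NNReal, ∀ t : ℝ, 0 < t → ∀ x, μ (closedBall x (2 * t)) ≤ C * μ (closedBall x t) := by
  have hA : 0 < A := zero_lt_one.trans_le h.one_le
  obtain ⟨C, hC⟩ := hdoub.exists_measure_qball_mul_le ((6 * A) ^ α⁻¹)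
  refine ⟨C, fun t ht x => ?_⟩
  calc μ (closedBall x (2 * t)) ≤ μ (qball ρ x ((3 * (2 * t)) ^ α⁻¹)) :=
        measure_mono (h.closedBall_subset_qball x (by positivity))
    _ = μ (qball ρ x ((6 * A) ^ α⁻¹ * (t / A) ^ α⁻¹)) := by
        rw [← Real.mul_rpow (by positivity) (by positivity)]
        congr 3
        field_simp
        norm_num
    _ ≤ C * μ (qball ρ x ((t / A) ^ α⁻¹)) := hC x _ (by positivity)
    _ ≤ C * μ (closedBall x t) := by
        gcongr
        exact (h.qball_subset_ball x ht).trans ball_subset_closedBall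

/-- Lebesgue's density theorem along closed balls, for closed sets. -/
theorem ae_tendsto_closedBall (h : DistComparable ρ A α) (hX : IsQMMS ρ μ)
    (hdoub : DoublingMeas ρ μ) {K : Set X} (hK : IsClosed K) :
    ∀ᵐ x ∂μ, x ∈ K → Tendsto (fun t => μ (K ∩ closedBall x t) / μ (closedBall x t))
      (𝓝[>] 0) (𝓝 1) := by
  have hle := h.borel_le hX
  have hsc := h.secondCountableTopology hX
  obtain ⟨C, hC⟩ := h.exists_measure_closedBall_two_mul_le hdoub
  have hKm := hK.measurableSet_borel
  have hBm : ∀ x t, MeasurableSet[borel X] (closedBall (x : X) t) := fun x t =>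
    isClosed_closedBall.measurableSet_borel
  have hball : ∀ x t, μ.trim hle (closedBall x t) = μ (closedBall x t) := fun x t =>
    trim_measurableSet_eq hle (hBm x t)
  have hinter : ∀ x t, μ.trim hle (K ∩ closedBall x t) = μ (K ∩ closedBall x t) := fun x t =>
    trim_measurableSet_eq hle (hKm.inter (hBm x t))
  have hborel : @BorelSpace X _ (borel X) := @BorelSpace.mk X _ (borel X) rfl
  have hdoub' : @IsUnifLocDoublingMeasure X _ (borel X) (μ.trim hle) := by
    refine @IsUnifLocDoublingMeasure.mk X _ (borel X) (μ.trim hle) ⟨C, ?_⟩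
    filter_upwards [self_mem_nhdsWithin] with t ht x
    rw [hball, hball]
    exact hC t ht x
  have hfin : @IsLocallyFiniteMeasure X (borel X) _ (μ.trim hle) := by
    refine @IsLocallyFiniteMeasure.mk X (borel X) _ _ fun x =>
      ⟨closedBall x 1, closedBall_mem_nhds x one_pos, ?_⟩
    rw [hball]
    exact (measure_mono (h.closedBall_subset_qball x one_pos)).trans_lt
      (hX.ball_lt_top x _ (by positivity))
  have key := @IsUnifLocDoublingMeasure.ae_tendsto_measure_inter_div X _ (borel X) (μ.trim hle)
    hdoub' hsc hborel hfin K 1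
  rw [@ae_restrict_iff' X (borel X) _ _ _ hKm] at key
  filter_upwards [ae_of_ae_trim hle key] with x hx hxK
  have := hx hxK (fun _ => x) id tendsto_id (by
    filter_upwards [self_mem_nhdsWithin] with t ht
    exact mem_closedBall_self (by simpa using le_of_lt ht))
  simpa only [hball, hinter, id] using this

theorem ae_eventually_qball_sdiff_le (h : DistComparable ρ A α) (hX : IsQMMS ρ μ)
    (hdoub : DoublingMeas ρ μ) {K : Set X} (hK : IsClosed K) :
    ∀ᵐ x ∂μ, x ∈ K → ∀ c : ENNReal, c ≠ 0 →
      ∀ᶠ r in 𝓝[>] 0, μ (qball ρ x r \ K) ≤ c * μ (qball ρ x r) := by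
  have hle := h.borel_le hX
  have hA : 0 < A := zero_lt_one.trans_le h.one_le
  have hKm : MeasurableSet K := hle K hK.measurableSet_borel
  obtain ⟨C, hC⟩ := hdoub.exists_measure_qball_mul_le ((3 * A) ^ α⁻¹)
  filter_upwards [h.ae_tendsto_closedBall hX hdoub hK] with x hx hxK c hc
  have hδ : Tendsto (fun r : ℝ => A * r ^ α) (𝓝[>] 0) (𝓝[>] 0) := by
    refine tendsto_nhdsWithin_iff.2 ⟨?_, ?_⟩
    · refine Tendsto.mono_left ?_ nhdsWithin_le_nhds
      have : Continuous fun r : ℝ => A * r ^ α := (Real.continuous_rpow_const h.pos.le).const_mul A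
      simpa [Real.zero_rpow h.pos.ne'] using this.tendsto 0
    · filter_upwards [self_mem_nhdsWithin] with r hr
      have : (0 : ℝ) < r := hr
      exact mem_Ioi.2 (by positivity)
  have hlim := (hx hxK).comp hδ
  have hlt : 1 - c / (C + 1) < 1 := ENNReal.sub_lt_self (by simp) (by simp)
    (ENNReal.div_ne_zero.2 ⟨hc, by finiteness⟩)
  filter_upwards [hlim.eventually (lt_mem_nhds hlt), self_mem_nhdsWithin] with r hr hr0
  have hr0 : 0 < r := hr0
  set t := A * r ^ α with ht
  have ht0 : 0 < t := by positivity
  have hbig : closedBall x t ⊆ qball ρ x ((3 * A) ^ α⁻¹ * r) := by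
    refine (h.closedBall_subset_qball x ht0).trans (qball_mono ρ x (le_of_eq ?_))
    rw [ht, ← mul_assoc, Real.mul_rpow (by positivity) (by positivity),
      Real.rpow_rpow_inv hr0.le h.pos.ne']
  have hB : μ (closedBall x t) ≤ C * μ (qball ρ x r) := (measure_mono hbig).trans (hC x r hr0)
  have hBtop : μ (closedBall x t) ≠ ∞ :=
    (hB.trans_lt (ENNReal.mul_lt_top (by simp) (hX.ball_lt_top x r hr0))).ne
  have hB0 : μ (closedBall x t) ≠ 0 :=
    ((hX.ball_pos x r hr0).trans_le (measure_mono (h.qball_subset_closedBall x r))).ne'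
  have hsplit : μ (K ∩ closedBall x t) + μ (closedBall x t \ K) = μ (closedBall x t) := by
    rw [inter_comm]; exact measure_inter_add_sdiff _ hKm
  have hdiff : μ (closedBall x t \ K) ≤ c / (C + 1) * μ (closedBall x t) := by
    have h1 : (1 - c / (C + 1)) * μ (closedBall x t) ≤ μ (K ∩ closedBall x t) :=
      (ENNReal.le_div_iff_mul_le (Or.inl hB0) (Or.inl hBtop)).1 hr.le
    rw [ENNReal.sub_mul (fun _ _ => hBtop), one_mul, tsub_le_iff_right] at h1
    rw [← ENNReal.add_le_add_iff_left (a := μ (K ∩ closedBall x t))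
      (measure_ne_top_of_subset inter_subset_right hBtop), hsplit]
    exact h1
  calc μ (qball ρ x r \ K) ≤ μ (closedBall x t \ K) :=
        measure_mono (sdiff_subset_sdiff_left (h.qball_subset_closedBall x r))
    _ ≤ c / (C + 1) * (C * μ (qball ρ x r)) := hdiff.trans (by gcongr)
    _ ≤ c / (C + 1) * ((C + 1) * μ (qball ρ x r)) := by gcongr; exact le_self_add
    _ = c * μ (qball ρ x r) := by
        rw [← mul_assoc, ENNReal.div_mul_cancel (by simp) (by finiteness)]

end DistComparable

end Density

section Median

open Filter Topology

theorem abs_medianVal_sub_le {X : Type*} [MeasurableSpace X] {μ : Measure X} {E K N : Set X}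
    {u : X → ℝ} {v ω : ℝ} (hE : μ E ≠ ∞) (hN : μ N = 0) (hK : μ (E \ K) < μ E / 2)
    (h : ∀ y ∈ (E ∩ K) \ N, |u y - v| ≤ ω) : |medianVal μ E u - v| ≤ ω := by
  have hlow : v - ω ∈ {θ : ℝ | μ {x ∈ E | u x < θ} ≤ μ E / 2} := by
    have hsub : {x ∈ E | u x < v - ω} ⊆ (E \ K) ∪ N := by
      rintro y ⟨hyE, hy⟩
      by_contra hcon
      simp only [mem_union, Set.mem_sdiff, not_or, not_and, not_not] at hcon
      linarith [(abs_le.1 (h y ⟨⟨hyE, hcon.1 hyE⟩, hcon.2⟩)).1]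
    calc _ ≤ μ (E \ K) + μ N := (measure_mono hsub).trans (measure_union_le _ _)
      _ ≤ μ E / 2 := by rw [hN, add_zero]; exact hK.le
  have hup : ∀ θ ∈ {θ : ℝ | μ {x ∈ E | u x < θ} ≤ μ E / 2}, θ ≤ v + ω := by
    intro θ hθ
    by_contra! hcon
    have hsub : E ⊆ ({x ∈ E | u x < θ} ∪ E \ K) ∪ N := by
      intro y hyE
      by_contra hy
      simp only [mem_union, mem_ofPred_eq, Set.mem_sdiff, not_or, not_and, not_not] at hy
      linarith [(abs_le.1 (h y ⟨⟨hyE, hy.1.2 hyE⟩, hy.2⟩)).2, not_lt.1 (hy.1.1 hyE)]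
    have hlt : μ E < μ E := calc
      μ E ≤ μ {x ∈ E | u x < θ} + μ (E \ K) + μ N :=
        (measure_mono hsub).trans
          ((measure_union_le _ _).trans (by gcongr; exact measure_union_le _ _))
      _ = μ {x ∈ E | u x < θ} + μ (E \ K) := by rw [hN, add_zero]
      _ < μ E / 2 + μ E / 2 := ENNReal.add_lt_add_of_le_of_lt
        (ne_top_of_le_ne_top (by finiteness) hθ) hθ hK
      _ = μ E := ENNReal.add_halves _
    exact lt_irrefl _ hlt
  have h1 : v - ω ≤ medianVal μ E u := le_csSup ⟨_, hup⟩ hlow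
  have h2 : medianVal μ E u ≤ v + ω := csSup_le ⟨_, hlow⟩ hup
  exact abs_le.2 ⟨by linarith, by linarith⟩

/-- A pointwise gradient estimate at small scales persists, with a quantitative bound, on the
closure of a set where the gradient is bounded. -/
theorem DistComparable.abs_sub_le_of_mem_closure {X : Type*} [PseudoMetricSpace X]
    {ρ : X → X → ℝ} {A α ε C M r : ℝ} (h : DistComparable ρ A α) (hε : 0 < ε)
    (htri : ∀ x y z, ρ x y ≤ C * max (ρ x z) (ρ z y)) {T : Set X} {u G : X → ℝ}
    (hgrad : ∀ x ∈ T, ∀ y ∈ T, ρ x y < 1 → |u x - u y| ≤ ρ x y ^ ε * (G x + G y))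
    (hC : 1 ≤ C) (hM : 0 ≤ M) (hr : 0 < r) (hCr : C * r < 1) {x y : X} (hx : x ∈ T)
    (hxM : G x ≤ M) (hy : y ∈ T) (hxy : ρ x y < r)
    (hcl : y ∈ closure {z ∈ T | G z ≤ M}) :
    |u y - u x| ≤ (C * r) ^ ε * (2 * M) + r ^ ε := by
  have hlim : Tendsto (fun η : ℝ => η ^ ε * |G y + M|) (𝓝[>] 0) (𝓝 0) := by
    have : Continuous fun η : ℝ => η ^ ε * |G y + M| :=
      (Real.continuous_rpow_const hε.le).mul_const _
    have h0 := this.tendsto 0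
    rw [Real.zero_rpow hε.ne', zero_mul] at h0
    exact h0.mono_left nhdsWithin_le_nhds
  have hrε : 0 < r ^ ε := by positivity
  obtain ⟨η, hηlt, hη0, hηr⟩ :=
    ((hlim.eventually (gt_mem_nhds hrε)).and (Ioo_mem_nhdsGT hr)).exists
  obtain ⟨z, ⟨hzT, hzM⟩, hz⟩ := Metric.mem_closure_iff.1 hcl (η ^ α / 3) (by positivity)
  have hyz : ρ y z < η := by
    have := h.closedBall_subset_qball y (t := η ^ α / 3) (by positivity)
      (Metric.mem_closedBall'.2 hz.le)
    rwa [mul_div_cancel₀ _ (by norm_num), Real.rpow_rpow_inv hη0.le h.pos.ne'] at this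
  have hxz : ρ x z ≤ C * r := (htri x z y).trans (by
    gcongr
    exact max_le hxy.le (hyz.trans hηr).le)
  have hr1 : r < 1 := (le_mul_of_one_le_left hr.le hC).trans_lt hCr
  have h1 : |u x - u z| ≤ (C * r) ^ ε * (2 * M) := by
    refine (hgrad x hx z hzT (hxz.trans_lt hCr)).trans ?_
    calc ρ x z ^ ε * (G x + G z) ≤ ρ x z ^ ε * (2 * M) :=
          mul_le_mul_of_nonneg_left (by linarith) (Real.rpow_nonneg (h.nonneg _ _) _)
      _ ≤ _ := mul_le_mul_of_nonneg_right
          (Real.rpow_le_rpow (h.nonneg _ _) hxz hε.le) (by positivity)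
  have h2 : |u y - u z| ≤ r ^ ε := by
    refine (hgrad y hy z hzT ((hyz.trans hηr).trans hr1)).trans ?_
    calc ρ y z ^ ε * (G y + G z) ≤ ρ y z ^ ε * |G y + M| :=
          mul_le_mul_of_nonneg_left (by linarith [le_abs_self (G y + M)])
            (Real.rpow_nonneg (h.nonneg _ _) _)
      _ ≤ η ^ ε * |G y + M| := mul_le_mul_of_nonneg_right
          (Real.rpow_le_rpow (h.nonneg _ _) hyz.le hε.le) (abs_nonneg _)
      _ ≤ r ^ ε := hηlt.le
  rw [abs_le] at *
  constructor <;> linarith [h1.1, h1.2, h2.1, h2.2]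

theorem ae_tendsto_medianVal {X : Type*} [MeasurableSpace X] {ρ : X → X → ℝ} {μ : Measure X}
    (hX : IsQMMS ρ μ) (hdoub : DoublingMeas ρ μ) {Ω : Set X} (hdens : MeasDensity ρ μ Ω)
    {S N : Set X} {u G : X → ℝ} {ε : ℝ} (hε : 0 < ε) (hN : μ N = 0)
    (hgrad : ∀ x ∈ S \ N, ∀ y ∈ S \ N, ρ x y < 1 → |u x - u y| ≤ ρ x y ^ ε * (G x + G y)) :
    ∀ᵐ x ∂μ, x ∈ Ω → (∃ r > 0, qball ρ x r ∩ Ω ⊆ S) →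
      Tendsto (fun r : ℝ => medianVal μ (qball ρ x r ∩ Ω) u) (𝓝[>] 0) (𝓝 (u x)) := by
  obtain ⟨_, A, α, hd⟩ := exists_distComparable hX.quasi
  obtain ⟨-, hid, -, C, hC, htri⟩ := hX.quasi
  obtain ⟨c, hc, hdens⟩ := hdens
  have hae : ∀ᵐ x ∂μ, ∀ n : ℕ, x ∈ closure {z ∈ S \ N | G z ≤ n} → ∀ c : ENNReal, c ≠ 0 →
      ∀ᶠ r in 𝓝[>] 0,
        μ (qball ρ x r \ closure {z ∈ S \ N | G z ≤ n}) ≤ c * μ (qball ρ x r) :=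
    ae_all_iff.2 fun n => hd.ae_eventually_qball_sdiff_le hX hdoub isClosed_closure
  filter_upwards [hae, measure_eq_zero_iff_ae_notMem.1 hN] with x hx hxN hxΩ ⟨r₀, hr₀, hsub⟩
  have hxS : x ∈ S \ N := ⟨hsub ⟨by rwa [qball, mem_ofPred_eq, (hid x x).2 rfl], hxΩ⟩, hxN⟩
  obtain ⟨n, hn⟩ := exists_nat_ge (G x)
  have hev := hx n (subset_closure ⟨hxS, hn⟩) (4 * ENNReal.ofReal c)⁻¹
    (ENNReal.inv_ne_zero.2 (by finiteness))
  have hC0 : 0 < C := zero_lt_one.trans_le hC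
  have hsmall : ∀ᶠ r in 𝓝[>] (0 : ℝ), |medianVal μ (qball ρ x r ∩ Ω) u - u x|
      ≤ (C * r) ^ ε * (2 * n) + r ^ ε := by
    filter_upwards [hev, Ioo_mem_nhdsGT hr₀, Ioo_mem_nhdsGT one_pos,
      Ioo_mem_nhdsGT (inv_pos.2 hC0)] with r hr hrr₀ hr1 hrC
    have hr0 : 0 < r := hr1.1
    have htop : μ (qball ρ x r ∩ Ω) ≠ ∞ :=
      measure_ne_top_of_subset inter_subset_left (hX.ball_lt_top x r hr0).ne
    have hdr := hdens x hxΩ r hr0 hr1.2.le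
    have hpos : μ (qball ρ x r ∩ Ω) ≠ 0 := fun h0 => by
      rw [h0, mul_zero] at hdr
      exact hdr.not_gt (hX.ball_pos x r hr0)
    refine abs_medianVal_sub_le (K := closure {z ∈ S \ N | G z ≤ n}) htop hN ?_ ?_
    · have hc0 : ENNReal.ofReal c ≠ 0 := by simpa using hc
      calc μ ((qball ρ x r ∩ Ω) \ closure {z ∈ S \ N | G z ≤ n})
          ≤ μ (qball ρ x r \ closure {z ∈ S \ N | G z ≤ n}) :=
            measure_mono (sdiff_subset_sdiff_left inter_subset_left)
        _ ≤ (4 * ENNReal.ofReal c)⁻¹ * (ENNReal.ofReal c * μ (qball ρ x r ∩ Ω)) :=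
            hr.trans (by gcongr)
        _ = μ (qball ρ x r ∩ Ω) / 2 / 2 := by
            rw [ENNReal.mul_inv (by simp) (by simp), mul_assoc, ← mul_assoc _ (ENNReal.ofReal c),
              ENNReal.inv_mul_cancel hc0 (by simp), one_mul, mul_comm, div_eq_mul_inv,
              div_eq_mul_inv, mul_assoc, ← ENNReal.mul_inv (by simp) (by simp)]
            norm_num
        _ < μ (qball ρ x r ∩ Ω) / 2 :=
            ENNReal.half_lt_self (by simpa using hpos) (by finiteness)
    · rintro y ⟨⟨⟨hyr, hyΩ⟩, hycl⟩, hyN⟩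
      have hCr : C * r < 1 := by
        have := mul_lt_mul_of_pos_left hrC.2 hC0
        rwa [mul_inv_cancel₀ hC0.ne'] at this
      exact hd.abs_sub_le_of_mem_closure hε htri hgrad hC n.cast_nonneg hr0 hCr hxS hn
        ⟨hsub ⟨qball_mono ρ x hrr₀.2.le hyr, hyΩ⟩, hyN⟩ hyr hycl
  have hbound : Tendsto (fun r : ℝ => (C * r) ^ ε * (2 * n) + r ^ ε) (𝓝[>] 0) (𝓝 0) := by
    have : Continuous fun r : ℝ => (C * r) ^ ε * (2 * n) + r ^ ε :=
      (((Real.continuous_rpow_const hε.le).comp (continuous_const_mul C)).mul_const _).add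
        (Real.continuous_rpow_const hε.le)
    have h0 := this.tendsto 0
    simp only [mul_zero, Real.zero_rpow hε.ne', zero_mul, add_zero] at h0
    exact h0.mono_left nhdsWithin_le_nhds
  rw [tendsto_iff_norm_sub_tendsto_zero]
  exact squeeze_zero' (Eventually.of_forall fun _ => norm_nonneg _) hsmall hbound

end Median

section FractionalGradient

theorem le_lqN {q : ℝ≥0∞} (hq : 0 < q) (a : ℤ → ℝ≥0∞) (k : ℤ) : a k ≤ lqN q a := by
  unfold lqN
  split_ifs with h
  · exact le_iSup a k
  · have hq' : 0 < q.toReal := ENNReal.toReal_pos hq.ne' h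
    rw [one_div, ENNReal.le_rpow_inv_iff hq']
    exact ENNReal.le_tsum (f := fun k => a k ^ q.toReal) k

theorem lpN_mono {X : Type*} [MeasurableSpace X] {μ : Measure X} {p : ℝ} (hp : 0 < p)
    {f g : X → ℝ≥0∞} (h : ∀ x, f x ≤ g x) : lpN μ p f ≤ lpN μ p g :=
  ENNReal.rpow_le_rpow (lintegral_mono fun x => ENNReal.rpow_le_rpow (h x) hp.le) (by positivity)

/-- A fractional gradient which is bounded in `L^p` grows almost everywhere at most
geometrically, at any prescribed rate. -/
theorem ae_exists_le_rpow_mul {X : Type*} [MeasurableSpace X] {μ : Measure X} {p δ : ℝ}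
    (hp : 0 < p) (hδ : 0 < δ) {g : ℕ → X → ℝ} (hg : ∀ k, AEMeasurable (g k) μ) {B : ℝ≥0∞}
    (hB : B ≠ ∞) (hgB : ∀ k, lpN μ p (fun x => ENNReal.ofReal (g k x)) ≤ B) :
    ∀ᵐ x ∂μ, ∃ C : ℝ, ∀ k, g k x ≤ ((2 : ℝ) ^ δ) ^ k * C := by
  set b : ℝ≥0∞ := ENNReal.ofReal ((2 : ℝ) ^ (-(δ * p))) with hb
  have hb1 : b < 1 := by
    rw [hb, ENNReal.ofReal_lt_one]
    exact Real.rpow_lt_one_of_one_lt_of_neg one_lt_two (by simpa using mul_pos hδ hp)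
  have hint : ∀ k, ∫⁻ x, ENNReal.ofReal (g k x) ^ p ∂μ ≤ B ^ p := fun k => by
    have := ENNReal.rpow_le_rpow (hgB k) hp.le
    rwa [lpN, one_div, ENNReal.rpow_inv_rpow hp.ne'] at this
  have hsum : ∫⁻ x, ∑' k, b ^ k * ENNReal.ofReal (g k x) ^ p ∂μ ≠ ∞ := by
    rw [lintegral_tsum fun k => ((hg k).ennreal_ofReal.pow_const p).const_mul _]
    refine ne_top_of_le_ne_top (b := ∑' k, b ^ k * B ^ p) ?_ (ENNReal.tsum_le_tsum fun k => ?_)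
    · rw [ENNReal.tsum_mul_right, ENNReal.tsum_geometric]
      exact ENNReal.mul_ne_top (ENNReal.inv_ne_top.2 (tsub_pos_of_lt hb1).ne')
        (ENNReal.rpow_ne_top_of_nonneg hp.le hB)
    · rw [lintegral_const_mul'' _ ((hg k).ennreal_ofReal.pow_const p)]
      gcongr
      exact hint k
  filter_upwards [ae_lt_top' (AEMeasurable.tsum fun k =>
    ((hg k).ennreal_ofReal.pow_const p).const_mul _) hsum] with x hx
  set T := ∑' k, b ^ k * ENNReal.ofReal (g k x) ^ p with hT
  refine ⟨T.toReal ^ p⁻¹, fun k => ?_⟩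
  have hk : b ^ k * ENNReal.ofReal (g k x) ^ p ≤ T :=
    ENNReal.le_tsum (f := fun k => b ^ k * ENNReal.ofReal (g k x) ^ p) k
  rcases le_or_gt (g k x) 0 with h0 | h0
  · exact h0.trans (by positivity)
  have hreal : ((2 : ℝ) ^ (-(δ * p))) ^ k * g k x ^ p ≤ T.toReal := by
    have := ENNReal.toReal_mono hx.ne hk
    rwa [ENNReal.toReal_mul, ENNReal.toReal_pow, ← ENNReal.toReal_rpow, hb,
      ENNReal.toReal_ofReal (by positivity), ENNReal.toReal_ofReal h0.le] at this
  have hbk : ((2 : ℝ) ^ (-(δ * p))) ^ k = ((((2 : ℝ) ^ δ) ^ k)⁻¹) ^ p := by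
    rw [Real.rpow_neg (by norm_num), Real.rpow_mul (by norm_num), Real.inv_rpow (by positivity),
      inv_pow, Real.rpow_pow_comm (by positivity)]
  rw [hbk, ← Real.mul_rpow (by positivity) h0.le] at hreal
  have := (Real.le_rpow_inv_iff_of_pos (by positivity) (by positivity) hp).2 hreal
  rwa [inv_mul_le_iff₀ (by positivity)] at this

/-- A fractional `s`-gradient which is bounded in `L^p` yields, at scales below one, a pointwise
gradient of order `s / 2`. -/
theorem exists_pointwise_gradient {X : Type*} [MeasurableSpace X] {ρ : X → X → ℝ}
    {μ : Measure X} (hρ : IsQuasiDist ρ) {Ω : Set X} (hΩ : MeasurableSet Ω) {u : X → ℝ} {s p : ℝ}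
    (hs : 0 < s) (hp : 0 < p) {g : ℤ → X → ℝ} (hg : g ∈ fracGrad ρ μ Ω s u) {B : ℝ≥0∞}
    (hB : B ≠ ∞) (hgB : ∀ k, lpN (μ.restrict Ω) p (fun x => ENNReal.ofReal (g k x)) ≤ B) :
    ∃ (G : X → ℝ) (N : Set X), μ N = 0 ∧ ∀ x ∈ Ω \ N, ∀ y ∈ Ω \ N, ρ x y < 1 →
      |u x - u y| ≤ ρ x y ^ (s / 2) * (G x + G y) := by
  obtain ⟨hg0, hgm, E, hE, hgE⟩ := hg
  have hae := ae_exists_le_rpow_mul hp (half_pos hs) (fun k : ℕ => hgm k) hB (fun k => hgB k)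
  rw [ae_restrict_iff' hΩ] at hae
  have hG : ∀ x, ∃ C : ℝ, (∃ C : ℝ, ∀ k : ℕ, g k x ≤ ((2 : ℝ) ^ (s / 2)) ^ k * C) →
      ∀ k : ℕ, g k x ≤ ((2 : ℝ) ^ (s / 2)) ^ k * C := fun x => by
    by_cases h : ∃ C : ℝ, ∀ k : ℕ, g k x ≤ ((2 : ℝ) ^ (s / 2)) ^ k * C
    · exact ⟨h.choose, fun _ => h.choose_spec⟩
    · exact ⟨0, fun h' => absurd h' h⟩
  choose G hG using hG
  refine ⟨G, E ∪ {x | ¬ (x ∈ Ω → ∃ C : ℝ, ∀ k : ℕ, g k x ≤ ((2 : ℝ) ^ (s / 2)) ^ k * C)},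
    measure_union_null hE hae, fun x hx y hy hxy => ?_⟩
  simp only [Set.mem_sdiff, mem_union, mem_ofPred_eq, not_or, not_not] at hx hy
  rcases (hρ.1 x y).eq_or_lt with h0 | h0
  · rw [← h0, (hρ.2.1 x y).1 h0.symm, Real.zero_rpow (half_pos hs).ne']
    simp
  obtain ⟨n, hn1, hn2⟩ := exists_mem_Ico_zpow h0 (one_lt_two (α := ℝ))
  have hn : n + 1 ≤ 0 := by
    by_contra! hcon
    have : (1 : ℝ) ≤ 2 ^ n := one_le_zpow₀ one_le_two (by omega)
    linarith
  obtain ⟨k, hk⟩ := Int.eq_ofNat_of_zero_le (show 0 ≤ -(n + 1) by omega)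
  have hkx := hG x (hx.2.2 hx.1) k
  have hky := hG y (hy.2.2 hy.1) k
  have hlt : ρ x y < (2 : ℝ) ^ (-(k : ℤ)) := by rw [← hk, neg_neg]; exact hn2
  have hge : (2 : ℝ) ^ (-(k : ℤ) - 1) ≤ ρ x y := by
    rw [← hk, neg_neg, add_sub_cancel_right]
    exact hn1
  have hscale : ρ x y ^ (s / 2) * ((2 : ℝ) ^ (s / 2)) ^ k ≤ 1 := by
    have h2 : ρ x y * 2 ^ k ≤ 1 := by
      rw [zpow_neg, zpow_natCast, ← one_div, lt_div_iff₀ (by positivity)] at hlt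
      exact hlt.le
    rw [Real.rpow_pow_comm (by positivity), ← Real.mul_rpow h0.le (by positivity)]
    exact Real.rpow_le_one (by positivity) h2 (half_pos hs).le
  have hsum0 : 0 ≤ G x + G y := by
    have h1 : 0 ≤ ((2 : ℝ) ^ (s / 2)) ^ k * (G x + G y) := by
      rw [mul_add]
      linarith [hg0 k x, hg0 k y]
    exact nonneg_of_mul_nonneg_right h1 (by positivity)
  calc |u x - u y| ≤ ρ x y ^ s * (g k x + g k y) :=
        hgE k x ⟨hx.1, hx.2.1⟩ y ⟨hy.1, hy.2.1⟩ hge hlt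
    _ ≤ ρ x y ^ s * (((2 : ℝ) ^ (s / 2)) ^ k * (G x + G y)) := by
        gcongr
        linarith
    _ = ρ x y ^ (s / 2) * (ρ x y ^ (s / 2) * ((2 : ℝ) ^ (s / 2)) ^ k) * (G x + G y) := by
        rw [show ρ x y ^ s = ρ x y ^ (s / 2) * ρ x y ^ (s / 2) by
          rw [← Real.rpow_add h0, add_halves]]
        ring
    _ ≤ ρ x y ^ (s / 2) * 1 * (G x + G y) := by gcongr
    _ = _ := by rw [mul_one]

theorem exists_lpN_le_of_MdotNorm_or_NdotNorm {X : Type*} [MeasurableSpace X] {ρ : X → X → ℝ}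
    {μ : Measure X} {Ω : Set X} {u : X → ℝ} {s p : ℝ} {q : ℝ≥0∞} (hp : 0 < p) (hq : 0 < q)
    (h : MdotNorm ρ μ Ω s p q u ≠ ∞ ∨ NdotNorm ρ μ Ω s p q u ≠ ∞) :
    ∃ g ∈ fracGrad ρ μ Ω s u, ∃ B : ℝ≥0∞, B ≠ ∞ ∧
      ∀ k, lpN (μ.restrict Ω) p (fun x => ENNReal.ofReal (g k x)) ≤ B := by
  rcases h with h | h
  · obtain ⟨g, hg⟩ := iInf_lt_iff.1 (lt_top_iff_ne_top.2 h)
    obtain ⟨hgmem, hg⟩ := iInf_lt_iff.1 hg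
    exact ⟨g, hgmem, _, hg.ne, fun k => lpN_mono hp fun x =>
      le_lqN hq (fun k => ENNReal.ofReal (g k x)) k⟩
  · obtain ⟨g, hg⟩ := iInf_lt_iff.1 (lt_top_iff_ne_top.2 h)
    obtain ⟨hgmem, hg⟩ := iInf_lt_iff.1 hg
    exact ⟨g, hgmem, _, hg.ne, fun k => le_lqN hq
      (fun k => lpN (μ.restrict Ω) p fun x => ENNReal.ofReal (g k x)) k⟩

end FractionalGradient



/-- Lemma 3.10(i): Lebesgue-type differentiation via medians for functions belonging
locally to a fractional Hajłasz–Sobolev space; in particular for members of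
`Ṁ^s_{p,q}(Ω)` or `Ṅ^s_{p,q}(Ω)`. -/
theorem median_tendsto_of_local_hajlasz
    {X : Type*} [MeasurableSpace X] (ρ : X → X → ℝ) (μ : Measure X)
    (hX : IsQMMS ρ μ) (hdoub : DoublingMeas ρ μ)
    (Ω : Set X) (hΩmeas : MeasurableSet Ω) (hΩne : Ω.Nonempty)
    (hdens : MeasDensity ρ μ Ω) :
    (∀ (u : X → ℝ) (ε p : ℝ), 0 < ε → 0 < p →
      (∀ x ∈ Ω, ∀ r : ℝ, 0 < r →
        ∃ g : X → ℝ, IsSGradOn ρ μ (qball ρ x r ∩ Ω) ε u g ∧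
          (∫⁻ y in qball ρ x r ∩ Ω, ENNReal.ofReal (g y) ^ p ∂μ) < ∞) →
      ∀ᵐ x ∂μ.restrict Ω,
        Filter.Tendsto (fun r : ℝ => medianVal μ (qball ρ x r ∩ Ω) u)
          (nhdsWithin 0 (Set.Ioi 0)) (nhds (u x))) ∧
    (∀ (u : X → ℝ) (s p : ℝ) (q : ℝ≥0∞), 0 < s → 0 < p → 0 < q →
      AEMeasurable u (μ.restrict Ω) →
      (MdotNorm ρ μ Ω s p q u ≠ ∞ ∨ NdotNorm ρ μ Ω s p q u ≠ ∞) →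
      ∀ᵐ x ∂μ.restrict Ω,
        Filter.Tendsto (fun r : ℝ => medianVal μ (qball ρ x r ∩ Ω) u)
          (nhdsWithin 0 (Set.Ioi 0)) (nhds (u x))) := by
  refine ⟨fun u ε p hε _ hu => ?_, fun u s p q hs hp hq _ hu => ?_⟩
  · rw [ae_restrict_iff' hΩmeas]
    obtain ⟨x₀, hx₀⟩ := hΩne
    obtain ⟨-, -, -, C, hC, htri⟩ := hX.quasi
    have hae : ∀ᵐ x ∂μ, ∀ n : ℕ, x ∈ Ω →
        (∃ r > 0, qball ρ x r ∩ Ω ⊆ qball ρ x₀ (n + 1) ∩ Ω) →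
        Filter.Tendsto (fun r : ℝ => medianVal μ (qball ρ x r ∩ Ω) u)
          (nhdsWithin 0 (Set.Ioi 0)) (nhds (u x)) := by
      refine ae_all_iff.2 fun n => ?_
      obtain ⟨g, ⟨-, -, E, hE, hgE⟩, -⟩ := hu x₀ hx₀ (n + 1) (by positivity)
      exact ae_tendsto_medianVal hX hdoub hdens hε hE fun x hx y hy _ => hgE x hx y hy
    filter_upwards [hae] with x hx hxΩ
    obtain ⟨n, hn⟩ := exists_nat_gt (C * max (ρ x₀ x) 1)
    refine hx n hxΩ ⟨1, one_pos, inter_subset_inter_left _ fun y hy => ?_⟩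
    have hle : C * max (ρ x₀ x) (ρ x y) ≤ C * max (ρ x₀ x) 1 := by
      gcongr
      exact le_of_lt hy
    exact ((htri x₀ y x).trans hle).trans_lt (hn.trans (lt_add_one _))
  · rw [ae_restrict_iff' hΩmeas]
    obtain ⟨g, hg, B, hB, hgB⟩ := exists_lpN_le_of_MdotNorm_or_NdotNorm hp hq hu
    obtain ⟨G, N, hN, hG⟩ := exists_pointwise_gradient hX.quasi hΩmeas hs hp hg hB hgB
    filter_upwards [ae_tendsto_medianVal hX hdoub hdens (half_pos hs) hN hG] with x hx hxΩ
    exact hx hxΩ ⟨1, one_pos, inter_subset_right⟩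

end HajlaszPaper
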